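/- arXiv:1511.01787 — 7 statements merged into one kernel-verified Lean document; each statement's English description precedes it below -/
import Mathlib

section
/- For every natural number n ≥ 1, the Fibonacci polynomial function F_n : ℝ → ℝ satisfies the ordinary differential equation (4 + ζ²)·F_n''(ζ) + 3ζ·F_n'(ζ) − (n² − 1)·F_n(ζ) = 0 for all real ζ. -/
/-- The derivative of `F n` in terms of `F n` and `F (n + 1)`. -/
lemma hasDerivAt_fib_poly (F : ℕ → ℝ → ℝ)
    (h1 : ∀ ζ : ℝ, F 1 ζ = 1)
    (h2 : ∀ ζ : ℝ, F 2 ζ = ζ)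
    (hrec : ∀ n : ℕ, 1 ≤ n → ∀ ζ : ℝ, F (n + 2) ζ = ζ * F (n + 1) ζ + F n ζ)
    (n : ℕ) (hn : 1 ≤ n) (x : ℝ) :
    HasDerivAt (F n) ((2 * n * F (n + 1) x - (n + 1) * x * F n x) / (4 + x ^ 2)) x ∧
      HasDerivAt (F (n + 1)) ((n * x * F (n + 1) x + 2 * (n + 1) * F n x) / (4 + x ^ 2)) x := by
  have hx : 4 + x ^ 2 ≠ 0 := by positivity
  induction n, hn using Nat.le_induction with
  | base =>
    have e1 : F 1 = fun _ => 1 := funext h1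
    have e2 : F 2 = fun ζ => ζ := funext h2
    simp only [Nat.reduceAdd, e1, e2]
    constructor
    · refine (hasDerivAt_const x (1 : ℝ)).congr_deriv ?_
      push_cast
      ring
    · refine (hasDerivAt_id' x).congr_deriv ?_
      field_simp
      push_cast
      ring
  | succ n hn ih =>
    obtain ⟨hF, hG⟩ := ih
    constructor
    · refine hG.congr_deriv ?_
      rw [hrec n hn x]
      push_cast
      ring
    · rw [show F (n + 1 + 1) = fun ζ => ζ * F (n + 1) ζ + F n ζ from funext (hrec n hn)]
      refine (((hasDerivAt_id' x).mul hG).add hF).congr_deriv ?_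
      field_simp
      push_cast
      ring

/-- For every natural number `n ≥ 1`, the Fibonacci polynomial function
`F_n : ℝ → ℝ` (defined by `F 1 ζ = 1`, `F 2 ζ = ζ`, `F (n+2) ζ = ζ * F (n+1) ζ + F n ζ`
for `n ≥ 1`) satisfies `(4 + ζ²)·F_n''(ζ) + 3ζ·F_n'(ζ) − (n² − 1)·F_n(ζ) = 0` for all real `ζ`. -/
theorem fib_poly_ode (F : ℕ → ℝ → ℝ)
    (h1 : ∀ ζ : ℝ, F 1 ζ = 1)
    (h2 : ∀ ζ : ℝ, F 2 ζ = ζ)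
    (hrec : ∀ n : ℕ, 1 ≤ n → ∀ ζ : ℝ, F (n + 2) ζ = ζ * F (n + 1) ζ + F n ζ) :
    ∀ n : ℕ, 1 ≤ n → ∀ ζ : ℝ,
      (4 + ζ ^ 2) * deriv (deriv (F n)) ζ + 3 * ζ * deriv (F n) ζ
        - ((n : ℝ) ^ 2 - 1) * F n ζ = 0 := by
  intro n hn x
  have hx : 4 + x ^ 2 ≠ 0 := by positivity
  have hD : deriv (F n) =
      fun y => (2 * n * F (n + 1) y - (n + 1) * y * F n y) / (4 + y ^ 2) :=
    funext fun y => (hasDerivAt_fib_poly F h1 h2 hrec n hn y).1.deriv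
  obtain ⟨hF, hG⟩ := hasDerivAt_fib_poly F h1 h2 hrec n hn x
  have hDD := ((hG.const_mul (2 * (n : ℝ))).sub
    (((hasDerivAt_id' x).const_mul ((n : ℝ) + 1)).mul hF)).div
    ((hasDerivAt_pow 2 x).const_add 4) hx
  rw [(hDD.congr_of_eventuallyEq (.of_eq hD)).deriv, hD]
  simp only [Pi.mul_apply, Pi.sub_apply]
  field_simp
  push_cast
  ring
end

section
/- For every natural number n ≥ 1, the Lucas polynomial function L_n : ℝ → ℝ satisfies the ordinary differential equation (4 + ζ²)·L_n''(ζ) + ζ·L_n'(ζ) − n²·L_n(ζ) = 0 for all real ζ. -/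
/-- The derivatives of two consecutive Lucas polynomial functions, as combinations of these
functions over `4 + ζ²`. -/
lemma hasDerivAt_lucas (L : ℕ → ℝ → ℝ)
    (h1 : ∀ ζ : ℝ, L 1 ζ = ζ)
    (h2 : ∀ ζ : ℝ, L 2 ζ = ζ ^ 2 + 2)
    (hrec : ∀ n : ℕ, 1 ≤ n → ∀ ζ : ℝ, L (n + 2) ζ = ζ * L (n + 1) ζ + L n ζ)
    (n : ℕ) (hn : 1 ≤ n) (ζ : ℝ) :
    HasDerivAt (L n) (n * (2 * L (n + 1) ζ - ζ * L n ζ) / (4 + ζ ^ 2)) ζ ∧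
      HasDerivAt (L (n + 1)) ((n + 1) * (ζ * L (n + 1) ζ + 2 * L n ζ) / (4 + ζ ^ 2)) ζ := by
  have hΔ : 4 + ζ ^ 2 ≠ 0 := by positivity
  induction n, hn using Nat.le_induction with
  | base =>
    have e1 : L 1 = fun x => x := funext h1
    have e2 : L (1 + 1) = fun x => x ^ 2 + 2 := funext h2
    rw [e1, e2]
    constructor
    · refine (hasDerivAt_id' ζ).congr_deriv ?_
      push_cast
      field_simp
      ring
    · refine (((hasDerivAt_id' ζ).pow 2).add_const (2 : ℝ)).congr_deriv ?_
      push_cast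
      field_simp
      ring
  | succ n hn ih =>
    obtain ⟨ih0, ih1⟩ := ih
    have e : L (n + 1 + 1) = fun x => x * L (n + 1) x + L n x := funext (hrec n hn)
    constructor
    · refine ih1.congr_deriv ?_
      rw [e]
      push_cast
      ring
    · rw [e]
      refine (((hasDerivAt_id' ζ).mul ih1).add ih0).congr_deriv ?_
      push_cast
      field_simp
      ring

/-- For every natural number `n ≥ 1`, the Lucas polynomial function
`L_n : ℝ → ℝ` (defined by `L 1 ζ = ζ`, `L 2 ζ = ζ² + 2`, `L (n+2) ζ = ζ * L (n+1) ζ + L n ζ`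
for `n ≥ 1`) satisfies `(4 + ζ²)·L_n''(ζ) + ζ·L_n'(ζ) − n²·L_n(ζ) = 0` for all real `ζ`. -/
theorem lucas_poly_ode (L : ℕ → ℝ → ℝ)
    (h1 : ∀ ζ : ℝ, L 1 ζ = ζ)
    (h2 : ∀ ζ : ℝ, L 2 ζ = ζ ^ 2 + 2)
    (hrec : ∀ n : ℕ, 1 ≤ n → ∀ ζ : ℝ, L (n + 2) ζ = ζ * L (n + 1) ζ + L n ζ) :
    ∀ n : ℕ, 1 ≤ n → ∀ ζ : ℝ,
      (4 + ζ ^ 2) * deriv (deriv (L n)) ζ + ζ * deriv (L n) ζ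
        - (n : ℝ) ^ 2 * L n ζ = 0 := by
  intro n hn ζ
  have hΔ : 4 + ζ ^ 2 ≠ 0 := by positivity
  have hd : deriv (L n) = fun x => n * (2 * L (n + 1) x - x * L n x) / (4 + x ^ 2) :=
    funext fun x => (hasDerivAt_lucas L h1 h2 hrec n hn x).1.deriv
  obtain ⟨h0, h0'⟩ := hasDerivAt_lucas L h1 h2 hrec n hn ζ
  have hdd := ((((h0'.const_mul 2).sub ((hasDerivAt_id' ζ).mul h0)).const_mul (n : ℝ)).div
    (((hasDerivAt_id' ζ).pow 2).const_add 4) hΔ).deriv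
  have hdd' : deriv (deriv (L n)) ζ = _ := (congrArg (fun f => deriv f ζ) hd).trans hdd
  rw [hdd', hd]
  simp only [Pi.mul_apply, Pi.sub_apply, Pi.pow_apply]
  push_cast
  field_simp
  ring
end

section
/- For every natural number n ≥ 1, the function y(ζ) = L_n(ζ)/√(ζ² + 4) satisfies the Fibonacci-type ordinary differential equation (4 + ζ²)·y''(ζ) + 3ζ·y'(ζ) − (n² − 1)·y(ζ) = 0 for all real ζ; that is, it is a second solution of the equation satisfied by the Fibonacci polynomials. -/
theorem lucas_eq_binet (L : ℕ → ℝ → ℝ)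
    (h1 : ∀ ζ : ℝ, L 1 ζ = ζ)
    (h2 : ∀ ζ : ℝ, L 2 ζ = ζ ^ 2 + 2)
    (hrec : ∀ n : ℕ, 1 ≤ n → ∀ ζ : ℝ, L (n + 2) ζ = ζ * L (n + 1) ζ + L n ζ)
    (n : ℕ) (hn : 1 ≤ n) (ζ : ℝ) :
    L n ζ = ((ζ + √(ζ ^ 2 + 4)) / 2) ^ n + ((ζ - √(ζ ^ 2 + 4)) / 2) ^ n := by
  have hr : √(ζ ^ 2 + 4) ^ 2 = ζ ^ 2 + 4 := Real.sq_sqrt (by positivity)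
  set r := √(ζ ^ 2 + 4)
  suffices h : L n ζ = ((ζ + r) / 2) ^ n + ((ζ - r) / 2) ^ n ∧
      L (n + 1) ζ = ((ζ + r) / 2) ^ (n + 1) + ((ζ - r) / 2) ^ (n + 1) from h.1
  induction n, hn using Nat.le_induction with
  | base =>
    refine ⟨by rw [h1]; ring, ?_⟩
    rw [h2]
    linear_combination -hr / 2
  | succ n hn ih =>
    refine ⟨ih.2, ?_⟩
    rw [show n + 1 + 1 = n + 2 from rfl, hrec n hn, ih.1, ih.2]
    simp only [pow_succ]
    linear_combination (-((ζ + r) / 2) ^ n / 4 - ((ζ - r) / 2) ^ n / 4) * hr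

theorem hasDerivAt_sqrt_sq_add_four (x : ℝ) :
    HasDerivAt (fun s : ℝ => √(s ^ 2 + 4)) (x / √(x ^ 2 + 4)) x := by
  refine (((hasDerivAt_id' x).fun_pow 2).add_const 4 |>.sqrt (by positivity)).congr_deriv ?_
  push_cast
  field_simp

theorem hasDerivAt_pow_of_log_deriv {f : ℝ → ℝ} {c x : ℝ} (hf : HasDerivAt f (c * f x) x) (n : ℕ) :
    HasDerivAt (fun s => f s ^ n) (n * c * f x ^ n) x := by
  refine (hf.fun_pow n).congr_deriv ?_
  cases n with
  | zero => simp
  | succ n => simp only [Nat.add_sub_cancel]; ring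

theorem hasDerivAt_binet_add_pow (n : ℕ) (x : ℝ) :
    HasDerivAt (fun s : ℝ => ((s + √(s ^ 2 + 4)) / 2) ^ n)
      (n * (1 / √(x ^ 2 + 4)) * ((x + √(x ^ 2 + 4)) / 2) ^ n) x := by
  have hr : √(x ^ 2 + 4) ≠ 0 := by positivity
  refine hasDerivAt_pow_of_log_deriv (f := fun s : ℝ => (s + √(s ^ 2 + 4)) / 2) ?_ n
  refine (((hasDerivAt_id' x).fun_add (hasDerivAt_sqrt_sq_add_four x)).div_const 2).congr_deriv ?_
  field_simp
  ring

theorem hasDerivAt_binet_sub_pow (n : ℕ) (x : ℝ) :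
    HasDerivAt (fun s : ℝ => ((s - √(s ^ 2 + 4)) / 2) ^ n)
      (n * (-1 / √(x ^ 2 + 4)) * ((x - √(x ^ 2 + 4)) / 2) ^ n) x := by
  have hr : √(x ^ 2 + 4) ≠ 0 := by positivity
  refine hasDerivAt_pow_of_log_deriv (f := fun s : ℝ => (s - √(s ^ 2 + 4)) / 2) ?_ n
  refine (((hasDerivAt_id' x).fun_sub (hasDerivAt_sqrt_sq_add_four x)).div_const 2).congr_deriv ?_
  field_simp
  ring

theorem fib_ode_of_hasDerivAt {P D : ℝ → ℝ} {c : ℝ}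
    (hP : ∀ x, HasDerivAt P (c * D x / √(x ^ 2 + 4)) x)
    (hD : ∀ x, HasDerivAt D (c * P x / √(x ^ 2 + 4)) x) (x : ℝ) :
    (4 + x ^ 2) * deriv (deriv (fun s : ℝ => P s / √(s ^ 2 + 4))) x
      + 3 * x * deriv (fun s : ℝ => P s / √(s ^ 2 + 4)) x
      - (c ^ 2 - 1) * (P x / √(x ^ 2 + 4)) = 0 := by
  have hr0 : ∀ s : ℝ, √(s ^ 2 + 4) ≠ 0 := fun s => by positivity
  have hd : deriv (fun s : ℝ => P s / √(s ^ 2 + 4)) =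
      fun s => c * D s / √(s ^ 2 + 4) ^ 2 - s * P s / √(s ^ 2 + 4) ^ 3 := by
    funext s
    rw [((hP s).fun_div (hasDerivAt_sqrt_sq_add_four s) (hr0 s)).deriv]
    have := hr0 s
    field_simp
  have hr := hasDerivAt_sqrt_sq_add_four x
  have hdd := (((hD x).const_mul c).fun_div (hr.fun_pow 2) (pow_ne_zero 2 (hr0 x))).fun_sub
    (((hasDerivAt_id' x).fun_mul (hP x)).fun_div (hr.fun_pow 3) (pow_ne_zero 3 (hr0 x)))
  rw [hd, hdd.deriv]
  beta_reduce
  have hx : 4 + x ^ 2 = √(x ^ 2 + 4) ^ 2 := by rw [Real.sq_sqrt (by positivity)]; ring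
  rw [hx]
  have := hr0 x
  generalize √(x ^ 2 + 4) = r at *
  push_cast
  field_simp
  ring


/-- For every natural number `n ≥ 1`, the function
`y(ζ) = L_n(ζ)/√(ζ² + 4)` satisfies the Fibonacci-type ODE
`(4 + ζ²)·y''(ζ) + 3ζ·y'(ζ) − (n² − 1)·y(ζ) = 0` for all real `ζ`, where `L_n` are the
Lucas polynomial functions. -/
theorem lucas_over_sqrt_fib_ode (L : ℕ → ℝ → ℝ)
    (h1 : ∀ ζ : ℝ, L 1 ζ = ζ)
    (h2 : ∀ ζ : ℝ, L 2 ζ = ζ ^ 2 + 2)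
    (hrec : ∀ n : ℕ, 1 ≤ n → ∀ ζ : ℝ, L (n + 2) ζ = ζ * L (n + 1) ζ + L n ζ) :
    ∀ n : ℕ, 1 ≤ n → ∀ ζ : ℝ,
      (4 + ζ ^ 2) * deriv (deriv (fun s : ℝ => L n s / Real.sqrt (s ^ 2 + 4))) ζ
        + 3 * ζ * deriv (fun s : ℝ => L n s / Real.sqrt (s ^ 2 + 4)) ζ
        - ((n : ℝ) ^ 2 - 1) * (L n ζ / Real.sqrt (ζ ^ 2 + 4)) = 0 := by

  intro n hn ζ
  simp only [lucas_eq_binet L h1 h2 hrec n hn]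
  refine fib_ode_of_hasDerivAt
    (P := fun s => ((s + √(s ^ 2 + 4)) / 2) ^ n + ((s - √(s ^ 2 + 4)) / 2) ^ n)
    (D := fun s => ((s + √(s ^ 2 + 4)) / 2) ^ n - ((s - √(s ^ 2 + 4)) / 2) ^ n)
    (fun x => ?_) (fun x => ?_) ζ
  · refine ((hasDerivAt_binet_add_pow n x).fun_add (hasDerivAt_binet_sub_pow n x)).congr_deriv ?_
    ring
  · refine ((hasDerivAt_binet_add_pow n x).fun_sub (hasDerivAt_binet_sub_pow n x)).congr_deriv ?_
    ring
end

section
/- For every natural number n ≥ 1, the single-variable Fibonacci function G_n : ℝ → ℝ satisfies the ordinary differential equation η(1 + 4η)·G_n''(η) − [(n − 1) + 2(2n − 5)η]·G_n'(η) + (n − 1)(n − 2)·G_n(η) = 0 for all real η. -/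
/-- Functions generated by the Fibonacci recurrence `G (n + 2) η = G (n + 1) η + η * G n η`
from constant initial terms are smooth. -/
theorem contDiff_of_fib_rec {G : ℕ → ℝ → ℝ} {a b : ℝ} {k : WithTop ℕ∞}
    (h1 : G 1 = fun _ => a) (h2 : G 2 = fun _ => b)
    (hrec : ∀ n : ℕ, 1 ≤ n → ∀ η : ℝ, G (n + 2) η = G (n + 1) η + η * G n η) :
    ∀ n : ℕ, 1 ≤ n → ContDiff ℝ k (G n) := by
  intro n hn
  induction n using Nat.twoStepInduction with
  | zero => omega
  | one => rw [h1]; exact contDiff_const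
  | more n ih₀ ih₁ =>
    rcases Nat.eq_zero_or_pos n with rfl | hpos
    · rw [h2]; exact contDiff_const
    · rw [show G (n + 2) = fun x => G (n + 1) x + x * G n x from funext (hrec n hpos)]
      exact (ih₁ (by omega)).add (contDiff_id.mul (ih₀ hpos))


/-- For every natural number `n ≥ 1`, the single-variable Fibonacci function
`G_n : ℝ → ℝ` (defined by `G 1 η = 1`, `G 2 η = 1`, `G (n+2) η = G (n+1) η + η * G n η`
for `n ≥ 1`) satisfies
`η(1 + 4η)·G_n''(η) − [(n − 1) + 2(2n − 5)η]·G_n'(η) + (n − 1)(n − 2)·G_n(η) = 0`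
for all real `η`. -/
theorem single_var_fib_ode (G : ℕ → ℝ → ℝ)
    (h1 : ∀ η : ℝ, G 1 η = 1)
    (h2 : ∀ η : ℝ, G 2 η = 1)
    (hrec : ∀ n : ℕ, 1 ≤ n → ∀ η : ℝ, G (n + 2) η = G (n + 1) η + η * G n η) :
    ∀ n : ℕ, 1 ≤ n → ∀ η : ℝ,
      η * (1 + 4 * η) * deriv (deriv (G n)) η
        - (((n : ℝ) - 1) + 2 * (2 * (n : ℝ) - 5) * η) * deriv (G n) η
        + ((n : ℝ) - 1) * ((n : ℝ) - 2) * G n η = 0 := by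
  have hG1 : G 1 = fun _ => 1 := funext h1
  have hG2 : G 2 = fun _ => 1 := funext h2
  have hdiff : ∀ n : ℕ, 1 ≤ n →
      Differentiable ℝ (G n) ∧ Differentiable ℝ (deriv (G n)) := fun n hn =>
    have hsmooth := contDiff_of_fib_rec hG1 hG2 hrec n hn
    ⟨hsmooth.differentiable (by norm_num), hsmooth.differentiable_deriv_two⟩
  have hd : ∀ n : ℕ, 1 ≤ n → ∀ η : ℝ,
      deriv (G (n + 2)) η = deriv (G (n + 1)) η + (G n η + η * deriv (G n) η) := by
    intro n hn η
    rw [show G (n + 2) = fun x => G (n + 1) x + x * G n x from funext (hrec n hn)]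
    have h := ((hdiff (n + 1) (by omega)).1 η).hasDerivAt.add
      ((hasDerivAt_id' η).mul ((hdiff n hn).1 η).hasDerivAt)
    rw [one_mul] at h
    exact h.deriv
  have hdd : ∀ n : ℕ, 1 ≤ n → ∀ η : ℝ,
      deriv (deriv (G (n + 2))) η = deriv (deriv (G (n + 1))) η
        + (2 * deriv (G n) η + η * deriv (deriv (G n)) η) := by
    intro n hn η
    rw [show deriv (G (n + 2)) = fun x => deriv (G (n + 1)) x + (G n x + x * deriv (G n) x)
      from funext (hd n hn)]
    have h := ((hdiff (n + 1) (by omega)).2 η).hasDerivAt.add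
      (((hdiff n hn).1 η).hasDerivAt.add
        ((hasDerivAt_id' η).mul ((hdiff n hn).2 η).hasDerivAt))
    rw [one_mul, ← add_assoc (deriv (G n) η), ← two_mul] at h
    exact h.deriv
  have hfirst : ∀ n : ℕ, 1 ≤ n → ∀ η : ℝ,
      (1 + 4 * η) * deriv (G (n + 1)) η = 2 * n * G (n + 1) η - (n + 1) * G n η := by
    intro n hn η
    induction n using Nat.twoStepInduction with
    | zero => omega
    | one => simp [hG1, hG2]; norm_num
    | more n ih₀ ih₁ =>
      rcases Nat.eq_zero_or_pos n with rfl | hpos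
      · have e := hd 1 le_rfl η
        have e' := hrec 1 le_rfl η
        norm_num [hG1, hG2] at e e' ⊢
        rw [e, e']
        ring
      · have i₀ := ih₀ hpos
        have i₁ := ih₁ (by omega)
        have e := hd (n + 1) (by omega) η
        have e' := hrec (n + 1) (by omega) η
        have e'' := hrec n hpos η
        push_cast at i₁ ⊢
        simp only [add_assoc, Nat.reduceAdd] at *
        rw [e, e']
        rw [e''] at i₁ ⊢
        linear_combination i₁ + η * i₀
  intro n hn η
  induction n using Nat.twoStepInduction with
  | zero => omega
  | one => simp [hG1]
  | more n ih₀ ih₁ =>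
    rcases Nat.eq_zero_or_pos n with rfl | hpos
    · simp [hG2]
    · have i₀ := ih₀ hpos
      have i₁ := ih₁ (by omega)
      rw [hdd n hpos, hd n hpos, hrec n hpos]
      push_cast at i₁ ⊢
      linear_combination i₁ + η * i₀ - hfirst n hpos η
end

section
/- For every natural number n ≥ 1, the single-variable Lucas function H_n : ℝ → ℝ satisfies the ordinary differential equation η(1 + 4η)·H_n''(η) − [(n − 1) + 2(2n − 3)η]·H_n'(η) + n(n − 1)·H_n(η) = 0 for all real η. -/
open Polynomial in
/-- The Fibonacci-type companion polynomials: `F 0 = 0`, `F 1 = 1`, `F (n+2) = F (n+1) + X * F n`. -/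
noncomputable def fibCompanion (R : Type*) [CommRing R] : ℕ → R[X]
  | 0 => 0
  | 1 => 1
  | n + 2 => fibCompanion R (n + 1) + X * fibCompanion R n

open Polynomial in
/-- The single-variable Lucas polynomials, written through their Fibonacci companions. -/
noncomputable def lucasSingle (R : Type*) [CommRing R] (n : ℕ) : R[X] :=
  2 * fibCompanion R (n + 1) - fibCompanion R n

namespace lucasSingle

open Polynomial

variable {R : Type*} [CommRing R]

theorem add_two (n : ℕ) :
    lucasSingle R (n + 2) = lucasSingle R (n + 1) + X * lucasSingle R n := by
  simp only [lucasSingle, fibCompanion]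
  ring

theorem succ_eq (n : ℕ) :
    lucasSingle R (n + 1) = fibCompanion R (n + 1) + 2 * X * fibCompanion R n := by
  simp only [lucasSingle, fibCompanion]
  ring

theorem derivative_succ (n : ℕ) :
    derivative (lucasSingle R (n + 1)) = ((n : R[X]) + 1) * fibCompanion R n := by
  induction n using Nat.twoStepInduction with
  | zero => simp [succ_eq, fibCompanion]
  | one => simp [succ_eq, fibCompanion]; norm_num
  | more n ih₀ ih₁ =>
    rw [add_two (n + 1), derivative_add, derivative_mul, derivative_X, ih₀, ih₁, succ_eq]
    simp only [fibCompanion]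
    push_cast
    ring

theorem derivative_fibCompanion (n : ℕ) :
    (1 + 4 * X) * derivative (fibCompanion R (n + 1))
      = 2 * (n : R[X]) * fibCompanion R (n + 1) - ((n : R[X]) + 1) * fibCompanion R n := by
  have h₀ := derivative_succ (R := R) (n + 1)
  have h₁ := derivative_succ (R := R) n
  rw [succ_eq] at h₀
  rw [lucasSingle] at h₁
  simp only [derivative_add, derivative_sub, derivative_mul, derivative_X, derivative_ofNat]
    at h₀ h₁
  push_cast at h₀
  linear_combination 2 * h₀ - h₁

theorem ode (n : ℕ) :
    X * (1 + 4 * X) * derivative (derivative (lucasSingle R (n + 1)))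
      - ((n : R[X]) + 2 * (2 * (n : R[X]) - 1) * X) * derivative (lucasSingle R (n + 1))
      + ((n : R[X]) + 1) * (n : R[X]) * lucasSingle R (n + 1) = 0 := by
  rw [derivative_succ]
  cases n with
  | zero => simp [fibCompanion]
  | succ m =>
    have h := derivative_fibCompanion (R := R) m
    have hc : derivative (((m + 1 : ℕ) : R[X]) + 1) = 0 := by simp
    rw [derivative_mul, hc, succ_eq, fibCompanion]
    push_cast
    linear_combination X * ((m : R[X]) + 2) * h

theorem eval_eq (H : ℕ → R → R) (h1 : ∀ x, H 1 x = 1) (h2 : ∀ x, H 2 x = 1 + 2 * x)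
    (hrec : ∀ n, 1 ≤ n → ∀ x, H (n + 2) x = H (n + 1) x + x * H n x) (n : ℕ) (x : R) :
    H (n + 1) x = (lucasSingle R (n + 1)).eval x := by
  induction n using Nat.twoStepInduction with
  | zero => simp [succ_eq, fibCompanion, h1]
  | one => simp [succ_eq, fibCompanion, h2]
  | more n ih₀ ih₁ =>
    rw [hrec (n + 1) n.succ_pos, ih₀, ih₁, add_two (n + 1)]
    simp

end lucasSingle


/-- For every natural number `n ≥ 1`, the single-variable Lucas function
`H_n : ℝ → ℝ` (defined by `H 1 η = 1`, `H 2 η = 1 + 2η`, `H (n+2) η = H (n+1) η + η * H n η`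
for `n ≥ 1`) satisfies
`η(1 + 4η)·H_n''(η) − [(n − 1) + 2(2n − 3)η]·H_n'(η) + n(n − 1)·H_n(η) = 0`
for all real `η`. -/
theorem single_var_lucas_ode (H : ℕ → ℝ → ℝ)
    (h1 : ∀ η : ℝ, H 1 η = 1)
    (h2 : ∀ η : ℝ, H 2 η = 1 + 2 * η)
    (hrec : ∀ n : ℕ, 1 ≤ n → ∀ η : ℝ, H (n + 2) η = H (n + 1) η + η * H n η) :
    ∀ n : ℕ, 1 ≤ n → ∀ η : ℝ,
      η * (1 + 4 * η) * deriv (deriv (H n)) η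
        - (((n : ℝ) - 1) + 2 * (2 * (n : ℝ) - 3) * η) * deriv (H n) η
        + (n : ℝ) * ((n : ℝ) - 1) * H n η = 0 := by
  intro n hn η
  obtain ⟨m, rfl⟩ := Nat.exists_eq_add_of_le' hn
  have hH : H (m + 1) = fun x => (lucasSingle ℝ (m + 1)).eval x :=
    funext (lucasSingle.eval_eq H h1 h2 hrec m)
  have hderiv (p : Polynomial ℝ) :
      deriv (fun x => p.eval x) = fun x => (Polynomial.derivative p).eval x :=
    funext fun _ => p.deriv
  rw [hH, hderiv, hderiv]
  have h := congrArg (Polynomial.eval η) (lucasSingle.ode (R := ℝ) m)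
  simp only [Polynomial.eval_add, Polynomial.eval_sub, Polynomial.eval_mul, Polynomial.eval_X,
    Polynomial.eval_one, Polynomial.eval_ofNat, Polynomial.eval_natCast, Polynomial.eval_zero] at h
  push_cast
  linear_combination h
end

section
/- For every natural number n ≥ 1, the function y(η) = √(1 + 4η)·G_n(η) satisfies, for all real η with 1 + 4η > 0, the ordinary differential equation η(1 + 4η)·y''(η) − [(n − 1) + 2(2n − 3)η]·y'(η) + n(n − 1)·y(η) = 0; that is, it is a second linearly independent solution of the equation satisfied by the single-variable Lucas functions. -/
open Filter Topology

/-- Binet's formula for the single-variable Fibonacci functions. -/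
lemma sqrt_mul_fib_eq_pow_sub_pow (G : ℕ → ℝ → ℝ)
    (h1 : ∀ η : ℝ, G 1 η = 1) (h2 : ∀ η : ℝ, G 2 η = 1)
    (hrec : ∀ n : ℕ, 1 ≤ n → ∀ η : ℝ, G (n + 2) η = G (n + 1) η + η * G n η)
    {η : ℝ} (hη : 0 ≤ 1 + 4 * η) (k : ℕ) :
    √(1 + 4 * η) * G (k + 1) η =
      ((1 + √(1 + 4 * η)) / 2) ^ (k + 1) - ((1 - √(1 + 4 * η)) / 2) ^ (k + 1) := by
  have hr := Real.sq_sqrt hη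
  set r := √(1 + 4 * η)
  induction k using Nat.twoStepInduction with
  | zero => rw [h1]; ring
  | one => rw [h2]; ring
  | more k ih ih' =>
    have hη' : η = (r ^ 2 - 1) / 4 := by linarith
    rw [hrec (k + 1) (by omega), mul_add, ih', mul_left_comm, ih, hη']
    ring

lemma hasDerivAt_sqrt_one_add_four_mul {η : ℝ} (hη : 0 < 1 + 4 * η) :
    HasDerivAt (fun s : ℝ => √(1 + 4 * s)) (2 / √(1 + 4 * η)) η := by
  have h : HasDerivAt (fun s : ℝ => 1 + 4 * s) 4 η := by
    simpa using ((hasDerivAt_id η).const_mul 4).const_add 1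
  convert h.sqrt hη.ne' using 1
  field_simp
  norm_num

lemma hasDerivAt_binet_roots_pow {η : ℝ} (hη : 0 < 1 + 4 * η) (k : ℕ) :
    HasDerivAt (fun s : ℝ => ((1 + √(1 + 4 * s)) / 2) ^ k)
        (k * ((1 + √(1 + 4 * η)) / 2) ^ (k - 1) / √(1 + 4 * η)) η ∧
      HasDerivAt (fun s : ℝ => ((1 - √(1 + 4 * s)) / 2) ^ k)
        (-(k * ((1 - √(1 + 4 * η)) / 2) ^ (k - 1) / √(1 + 4 * η))) η := by
  have h := hasDerivAt_sqrt_one_add_four_mul hη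
  constructor
  · refine (((h.const_add 1).div_const 2).fun_pow k).congr_deriv ?_
    ring
  · refine (((h.const_sub 1).div_const 2).fun_pow k).congr_deriv ?_
    ring


/-- For every natural number `n ≥ 1`, the function
`y(η) = √(1 + 4η)·G_n(η)` satisfies, for all real `η` with `1 + 4η > 0`, the ODE
`η(1 + 4η)·y''(η) − [(n − 1) + 2(2n − 3)η]·y'(η) + n(n − 1)·y(η) = 0`,
where `G_n` are the single-variable Fibonacci functions. -/
theorem sqrt_mul_fib_single_var_lucas_ode (G : ℕ → ℝ → ℝ)
    (h1 : ∀ η : ℝ, G 1 η = 1)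
    (h2 : ∀ η : ℝ, G 2 η = 1)
    (hrec : ∀ n : ℕ, 1 ≤ n → ∀ η : ℝ, G (n + 2) η = G (n + 1) η + η * G n η) :
    ∀ n : ℕ, 1 ≤ n → ∀ η : ℝ, 1 + 4 * η > 0 →
      η * (1 + 4 * η) * deriv (deriv (fun s : ℝ => Real.sqrt (1 + 4 * s) * G n s)) η
        - (((n : ℝ) - 1) + 2 * (2 * (n : ℝ) - 3) * η)
            * deriv (fun s : ℝ => Real.sqrt (1 + 4 * s) * G n s) η
        + (n : ℝ) * ((n : ℝ) - 1) * (Real.sqrt (1 + 4 * η) * G n η) = 0 := by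
  intro n hn η hη
  obtain ⟨k, rfl⟩ : ∃ k, n = k + 1 := ⟨n - 1, by omega⟩
  have hev : ∀ t : ℝ, 0 < 1 + 4 * t → ∀ᶠ s in 𝓝 t, 0 < 1 + 4 * s := fun t ht =>
    (by fun_prop : Continuous fun s : ℝ => 1 + 4 * s).continuousAt.eventually_const_lt ht
  have hd1 : ∀ t : ℝ, 0 < 1 + 4 * t →
      deriv (fun s : ℝ => √(1 + 4 * s) * G (k + 1) s) t =
        (k + 1) * (((1 + √(1 + 4 * t)) / 2) ^ k + ((1 - √(1 + 4 * t)) / 2) ^ k)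
          / √(1 + 4 * t) := by
    intro t ht
    obtain ⟨ha, hb⟩ := hasDerivAt_binet_roots_pow ht (k + 1)
    have heq : (fun s : ℝ => √(1 + 4 * s) * G (k + 1) s) =ᶠ[𝓝 t] fun s =>
        ((1 + √(1 + 4 * s)) / 2) ^ (k + 1) - ((1 - √(1 + 4 * s)) / 2) ^ (k + 1) := by
      filter_upwards [hev t ht] with s hs
      exact sqrt_mul_fib_eq_pow_sub_pow G h1 h2 hrec hs.le k
    rw [heq.deriv_eq, (ha.fun_sub hb).deriv, Nat.add_sub_cancel]
    push_cast
    ring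
  have hr0 : √(1 + 4 * η) ≠ 0 := (Real.sqrt_pos.2 hη).ne'
  obtain ⟨ha, hb⟩ := hasDerivAt_binet_roots_pow hη k
  have hd2 := (((ha.fun_add hb).const_mul ((k : ℝ) + 1)).fun_div
    (hasDerivAt_sqrt_one_add_four_mul hη) hr0).deriv
  have hd1' := (hev η hη).mono hd1
  rw [EventuallyEq.deriv_eq hd1', hd2, hd1 η hη,
    sqrt_mul_fib_eq_pow_sub_pow G h1 h2 hrec hη.le k]
  have hr := Real.sq_sqrt hη.le
  set r := √(1 + 4 * η)
  have hpow : ∀ x : ℝ, (k : ℝ) * x ^ k = k * x ^ (k - 1) * x := by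
    intro x
    cases k with
    | zero => simp
    | succ m => rw [Nat.add_sub_cancel, pow_succ, mul_assoc]
  have hA := hpow ((1 + r) / 2)
  have hB := hpow ((1 - r) / 2)
  have hη' : η = (r ^ 2 - 1) / 4 := by linarith
  rw [hη', pow_succ ((1 + r) / 2), pow_succ ((1 - r) / 2)]
  generalize ((1 + r) / 2) ^ k = A at *
  generalize ((1 - r) / 2) ^ k = B at *
  generalize ((1 + r) / 2) ^ (k - 1) = A' at *
  generalize ((1 - r) / 2) ^ (k - 1) = B' at *
  push_cast
  field_simp
  linear_combination (-4 * r ^ 3 * (k + 1) * (r - 1)) * hA - 4 * r ^ 3 * (k + 1) * (1 + r) * hB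
end

section
/- For every real parameter μ, the function y(ζ) = cosh(μ·arsinh(ζ/2)) satisfies the Lucas-type auxiliary ordinary differential equation (4 + ζ²)·y''(ζ) + ζ·y'(ζ) − μ²·y(ζ) = 0 for all real ζ. -/
theorem hasDerivAt_arsinh_half (x : ℝ) :
    HasDerivAt (fun s : ℝ => Real.arsinh (s / 2)) (√(4 + x ^ 2))⁻¹ x := by
  have h : √(4 + x ^ 2) = 2 * √(1 + (x / 2) ^ 2) := by
    rw [show 4 + x ^ 2 = 2 ^ 2 * (1 + (x / 2) ^ 2) by ring, Real.sqrt_mul (by positivity),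
      Real.sqrt_sq (by norm_num)]
  refine ((hasDerivAt_id' x).div_const 2).arsinh.congr_deriv ?_
  rw [h, mul_inv, smul_eq_mul]
  ring

theorem hasDerivAt_sqrt_four_add_sq (x : ℝ) :
    HasDerivAt (fun s : ℝ => √(4 + s ^ 2)) (x / √(4 + x ^ 2)) x := by
  have h : 4 + x ^ 2 ≠ 0 := by positivity
  refine (((hasDerivAt_pow 2 x).const_add 4).sqrt h).congr_deriv ?_
  rw [Nat.cast_ofNat, pow_one, mul_div_mul_left _ _ two_ne_zero]

theorem hasDerivAt_cosh_mul_arsinh_half (μ x : ℝ) :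
    HasDerivAt (fun s : ℝ => Real.cosh (μ * Real.arsinh (s / 2)))
      (μ * Real.sinh (μ * Real.arsinh (x / 2)) / √(4 + x ^ 2)) x := by
  convert ((hasDerivAt_arsinh_half x).const_mul μ).cosh using 1
  ring

/-- For every real parameter `μ`, the function
`y(ζ) = cosh(μ·arsinh(ζ/2))` satisfies the Lucas-type auxiliary ODE
`(4 + ζ²)·y''(ζ) + ζ·y'(ζ) − μ²·y(ζ) = 0` for all real `ζ`. -/
theorem cosh_arsinh_lucas_ode (μ : ℝ) :
    ∀ ζ : ℝ,
      (4 + ζ ^ 2) * deriv (deriv (fun s : ℝ => Real.cosh (μ * Real.arsinh (s / 2)))) ζ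
        + ζ * deriv (fun s : ℝ => Real.cosh (μ * Real.arsinh (s / 2))) ζ
        - μ ^ 2 * Real.cosh (μ * Real.arsinh (ζ / 2)) = 0 := by
  intro ζ
  have hw : √(4 + ζ ^ 2) ≠ 0 := by positivity
  have hsq : 4 + ζ ^ 2 = √(4 + ζ ^ 2) ^ 2 := (Real.sq_sqrt (by positivity)).symm
  have hy' : deriv (fun s : ℝ => Real.cosh (μ * Real.arsinh (s / 2))) =
      fun s => μ * Real.sinh (μ * Real.arsinh (s / 2)) / √(4 + s ^ 2) :=
    funext fun s => (hasDerivAt_cosh_mul_arsinh_half μ s).deriv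
  have hy'' := ((((hasDerivAt_arsinh_half ζ).const_mul μ).sinh.const_mul μ).fun_div
    (hasDerivAt_sqrt_four_add_sq ζ) hw).deriv
  rw [hy', hy'']
  beta_reduce
  generalize √(4 + ζ ^ 2) = w at hw hsq
  rw [hsq]
  field_simp
  ring
end
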